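/- Let n ≥ 1 and m ≥ 1 be integers with 2m ≤ n + 1. In ℝ^{n+2}, let e_1, …, e_{n+2} be the standard basis vectors and set V_j = e_j for 1 ≤ j ≤ n+1, V_{n+2} = e_{n+2} − e_{n+1}, and V_{n+3} = m·e_{n+2} − (e_1 + ⋯ + e_n). Let Δ be the convex hull of {0, V_1, …, V_{n+3}}. Then the Lebesgue measure of Δ equals (n+1)/(n+2)!. -/

import Mathlib

open MeasureTheory

/-- The corner simplex of size `r`: nonnegative vectors with coordinate sum at most `r`. -/
def cornerSimplex (ι : Type*) [Fintype ι] (r : ℝ) : Set (ι → ℝ) :=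
  {x | (∀ i, 0 ≤ x i) ∧ ∑ i, x i ≤ r}

theorem isClosed_cornerSimplex (ι : Type*) [Fintype ι] (r : ℝ) :
    IsClosed (cornerSimplex ι r) := by
  refine IsClosed.inter (s₁ := {x : ι → ℝ | ∀ i, 0 ≤ x i}) ?_ ?_
  · simp only [Set.ofPred_forall]
    exact isClosed_iInter fun i => isClosed_le continuous_const (continuous_apply i)
  · exact isClosed_le (continuous_finsetSum _ fun i _ => continuous_apply i) continuous_const

theorem cornerSimplex_eq_empty (ι : Type*) [Fintype ι] {r : ℝ} (hr : r < 0) :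
    cornerSimplex ι r = ∅ :=
  Set.eq_empty_of_forall_notMem fun _ hx =>
    (hx.2.trans_lt hr).not_ge (Finset.sum_nonneg fun i _ => hx.1 i)

theorem volume_cornerSimplex (d : ℕ) {r : ℝ} (hr : 0 ≤ r) :
    volume (cornerSimplex (Fin d) r) = ENNReal.ofReal (r ^ d / d.factorial) := by
  induction d generalizing r with
  | zero =>
    have : cornerSimplex (Fin 0) r = Set.univ := by
      ext x; simp [cornerSimplex, hr]
    simp [this, volume_pi]
  | succ d ih =>
    have hpre : cornerSimplex (Fin (d + 1)) r =
        MeasurableEquiv.piFinSuccAbove (fun _ => ℝ) 0 ⁻¹'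
          {p : ℝ × (Fin d → ℝ) | 0 ≤ p.1 ∧ p.2 ∈ cornerSimplex (Fin d) (r - p.1)} := by
      ext x
      simp [cornerSimplex, MeasurableEquiv.piFinSuccAbove, Fin.forall_fin_succ, Fin.sum_univ_succ,
        Fin.tail, and_assoc, le_sub_iff_add_le']
    have hmeas : MeasurableSet
        {p : ℝ × (Fin d → ℝ) | 0 ≤ p.1 ∧ p.2 ∈ cornerSimplex (Fin d) (r - p.1)} := by
      simp only [cornerSimplex, Set.mem_ofPred_eq]
      measurability
    rw [hpre, (volume_preserving_piFinSuccAbove (fun _ => ℝ) 0).measure_preimage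
      hmeas.nullMeasurableSet, Measure.volume_eq_prod, Measure.prod_apply hmeas]
    have hslice : ∀ t : ℝ, volume (Prod.mk t ⁻¹'
        {p : ℝ × (Fin d → ℝ) | 0 ≤ p.1 ∧ p.2 ∈ cornerSimplex (Fin d) (r - p.1)}) =
        (Set.Icc 0 r).indicator
          (fun t => ENNReal.ofReal ((r - t) ^ d / d.factorial)) t := by
      intro t
      by_cases ht : t ∈ Set.Icc 0 r
      · rw [Set.indicator_of_mem ht, ← ih (sub_nonneg.2 ht.2)]
        simp [ht.1]
      · rw [Set.indicator_of_notMem ht]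
        rcases lt_or_ge t 0 with h0 | h0
        · simp [h0.not_ge]
        · have : r < t := by by_contra hc; exact ht ⟨h0, not_lt.1 hc⟩
          simp [cornerSimplex_eq_empty _ (sub_neg.2 this)]
    simp only [hslice]
    rw [lintegral_indicator measurableSet_Icc, ← ofReal_integral_eq_lintegral_ofReal]
    · congr 1
      rw [integral_Icc_eq_integral_Ioc, ← intervalIntegral.integral_of_le hr,
        intervalIntegral.integral_div,
        intervalIntegral.integral_comp_sub_left (fun t => t ^ d) r]
      simp [Nat.factorial_succ, div_div]
    · exact Continuous.integrableOn_Icc (by fun_prop)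
    · filter_upwards [ae_restrict_mem measurableSet_Icc] with t ht
      have := sub_nonneg.2 ht.2
      simp only [Pi.zero_apply]
      positivity

theorem isCompact_cornerSimplex (ι : Type*) [Fintype ι] (r : ℝ) :
    IsCompact (cornerSimplex ι r) := by
  refine (isCompact_Icc (a := (0 : ι → ℝ)) (b := fun _ => r)).of_isClosed_subset
    (isClosed_cornerSimplex ι r) fun x hx => ⟨hx.1, fun i => ?_⟩
  exact (Finset.single_le_sum (fun j _ => hx.1 j) (Finset.mem_univ i)).trans hx.2

/-- The linear map replacing the `i`-th standard basis vector by `h`. -/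
def replaceBasisVector {ι : Type*} [DecidableEq ι] (h : ι → ℝ) (i : ι) : (ι → ℝ) →ₗ[ℝ] (ι → ℝ) :=
  LinearMap.transvection (LinearMap.proj i) (h - Pi.single i 1)

theorem replaceBasisVector_apply {ι : Type*} [DecidableEq ι]
    (h : ι → ℝ) (i : ι) (u : ι → ℝ) (j : ι) :
    replaceBasisVector h i u j = u j + u i * (h j - (Pi.single i 1 : ι → ℝ) j) := by
  simp [replaceBasisVector, LinearMap.transvection.apply]

theorem det_replaceBasisVector {ι : Type*} [Fintype ι] [DecidableEq ι] (h : ι → ℝ) (i : ι) :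
    LinearMap.det (replaceBasisVector h i) = h i := by
  simp [replaceBasisVector, LinearMap.transvection.det]

/-- A combination of the standard basis and `h` with nonnegative weights of total at most `1`
lies in the convex hull of the origin, the standard basis and `h`. -/
theorem add_smul_mem_convexHull {ι : Type*} [Fintype ι] [DecidableEq ι]
    (h w : ι → ℝ) (t : ℝ) (hw : ∀ i, 0 ≤ w i) (ht : 0 ≤ t)
    (hsum : ∑ i, w i + t ≤ 1) :
    w + t • h ∈ convexHull ℝ ({0} ∪ Set.range (fun i : ι => (Pi.single i 1 : ι → ℝ)) ∪ {h}) := by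
  have key := (convex_convexHull ℝ
    ({0} ∪ Set.range (fun i : ι => (Pi.single i 1 : ι → ℝ)) ∪ {h})).sum_mem
    (t := Finset.univ)
    (w := fun o : Option (Option ι) => o.elim (1 - (∑ i, w i + t)) fun o => o.elim t w)
    (z := fun o => o.elim 0 fun o => o.elim h fun i => Pi.single i 1)
    (by
      rintro (_ | _ | i) -
      · exact sub_nonneg.2 hsum
      · exact ht
      · exact hw i)
    (by simp only [Fintype.sum_option, Option.elim]; ring)
    (by
      rintro (_ | _ | i) - <;> apply subset_convexHull <;> simp)
  simp only [Fintype.sum_option, Option.elim, smul_zero, zero_add] at key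
  rwa [← pi_eq_sum_univ' w, add_comm] at key

theorem exists_of_mem_convexHull {ι : Type*} [Fintype ι] [DecidableEq ι] (h x : ι → ℝ)
    (hx : x ∈ convexHull ℝ ({0} ∪ Set.range (fun i : ι => (Pi.single i 1 : ι → ℝ)) ∪ {h})) :
    ∃ (w : ι → ℝ) (t : ℝ), (∀ i, 0 ≤ w i) ∧ 0 ≤ t ∧ ∑ i, w i + t ≤ 1 ∧ x = w + t • h := by
  refine convexHull_min (t := {x | ∃ (w : ι → ℝ) (t : ℝ),
    (∀ i, 0 ≤ w i) ∧ 0 ≤ t ∧ ∑ i, w i + t ≤ 1 ∧ x = w + t • h}) ?_ ?_ hx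
  · rintro _ ((rfl | ⟨i, rfl⟩) | rfl)
    · exact ⟨0, 0, by simp⟩
    · refine ⟨Pi.single i 1, 0, fun j => ?_, le_rfl, by simp, by simp⟩
      exact (Pi.single_nonneg.2 zero_le_one : (0 : ι → ℝ) ≤ Pi.single i 1) j
    · exact ⟨0, 1, by simp⟩
  · rintro _ ⟨w, t, hw, ht, hs, rfl⟩ _ ⟨w', t', hw', ht', hs', rfl⟩ a b ha hb hab
    refine ⟨a • w + b • w', a * t + b * t',
      fun i => add_nonneg (mul_nonneg ha (hw i)) (mul_nonneg hb (hw' i)), by positivity, ?_, ?_⟩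
    · simp only [Pi.add_apply, Pi.smul_apply, smul_eq_mul, Finset.sum_add_distrib,
        ← Finset.mul_sum]
      obtain rfl : b = 1 - a := by linarith
      nlinarith
    · ext j
      simp only [Pi.add_apply, Pi.smul_apply, smul_eq_mul]
      ring

/-- Triangulation of the convex hull of the origin, the standard basis and `h`: besides the corner
simplex, there is one simplex for each basis vector that `h` can replace. -/
theorem convexHull_eq_union_cornerSimplex {ι : Type*} [Fintype ι] [DecidableEq ι]
    (h : ι → ℝ) (s : Finset ι) (hs : ∀ i ∈ s, h i = -1)
    (hs' : ∀ i ∉ s, 0 ≤ h i) (hsum : ∑ i, h i ≤ 1) :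
    convexHull ℝ ({0} ∪ Set.range (fun i : ι => (Pi.single i 1 : ι → ℝ)) ∪ {h}) =
      cornerSimplex ι 1 ∪ ⋃ i ∈ s, replaceBasisVector h i '' cornerSimplex ι 1 := by
  apply Set.Subset.antisymm
  · intro x hx
    obtain ⟨w, t, hw, ht, hwt, rfl⟩ := exists_of_mem_convexHull h x hx
    by_cases hlt : ∃ i ∈ s, w i < t
    · obtain ⟨k, hk, hkt⟩ := hlt
      obtain ⟨i, hi, hmin⟩ := s.exists_min_image w ⟨k, hk⟩
      have hit : w i < t := (hmin k hk).trans_lt hkt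
      refine Or.inr (Set.mem_iUnion₂.2 ⟨i, hi,
        w + w i • h + (t - w i) • Pi.single i 1, ⟨fun j => ?_, ?_⟩, ?_⟩)
      · have h1 : 0 ≤ (t - w i) * (Pi.single i 1 : ι → ℝ) j :=
          mul_nonneg (sub_nonneg.2 hit.le)
            ((Pi.single_nonneg.2 zero_le_one : (0 : ι → ℝ) ≤ Pi.single i 1) j)
        have h2 : 0 ≤ w j + w i * h j := by
          by_cases hj : j ∈ s
          · rw [hs j hj]; linarith [hmin j hj]
          · exact add_nonneg (hw j) (mul_nonneg (hw i) (hs' j hj))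
        exact add_nonneg h2 h1
      · simp only [Pi.add_apply, Pi.smul_apply, smul_eq_mul, Finset.sum_add_distrib,
          ← Finset.mul_sum, Finset.sum_pi_single', Finset.mem_univ, if_true]
        nlinarith [hw i]
      · ext j
        simp only [replaceBasisVector_apply, Pi.add_apply, Pi.smul_apply, smul_eq_mul, hs i hi,
          Pi.single_eq_same]
        ring
    · push Not at hlt
      refine Or.inl ⟨fun j => ?_, ?_⟩
      · simp only [Pi.add_apply, Pi.smul_apply, smul_eq_mul]
        by_cases hj : j ∈ s
        · rw [hs j hj]; linarith [hlt j hj]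
        · exact add_nonneg (hw j) (mul_nonneg ht (hs' j hj))
      · simp only [Pi.add_apply, Pi.smul_apply, smul_eq_mul, Finset.sum_add_distrib,
          ← Finset.mul_sum]
        nlinarith
  · refine Set.union_subset (fun x hx => ?_) (Set.iUnion₂_subset fun i _ => ?_)
    · simpa using add_smul_mem_convexHull h x 0 hx.1 le_rfl (by simpa using hx.2)
    · rintro _ ⟨u, hu, rfl⟩
      have : replaceBasisVector h i u = Function.update u i 0 + u i • h := by
        ext j
        rcases eq_or_ne j i with rfl | hj
        · simp [replaceBasisVector_apply]; ring
        · simp [replaceBasisVector_apply, hj]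
      rw [this]
      refine add_smul_mem_convexHull _ _ _ (fun j => ?_) (hu.1 i) ?_
      · rcases eq_or_ne j i with rfl | hj
        · simp
        · simpa [hj] using hu.1 j
      · rw [Finset.sum_update_of_mem (Finset.mem_univ i), zero_add,
          ← Finset.sum_singleton u i, Finset.sum_sdiff (Finset.subset_univ {i})]
        exact hu.2

theorem volume_linearMap_eq_zero {ι : Type*} [Fintype ι] (f : (ι → ℝ) →ₗ[ℝ] ℝ) (hf : f ≠ 0) :
    volume {x | f x = 0} = 0 :=
  Measure.addHaar_submodule volume (LinearMap.ker f) (by rwa [Ne, LinearMap.ker_eq_top])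

theorem volume_convexHull_eq_mul {ι : Type*} [Fintype ι] [DecidableEq ι]
    (h : ι → ℝ) (s : Finset ι) (hs : ∀ i ∈ s, h i = -1)
    (hs' : ∀ i ∉ s, 0 ≤ h i) (hsum : ∑ i, h i ≤ 1) :
    volume (convexHull ℝ ({0} ∪ Set.range (fun i : ι => (Pi.single i 1 : ι → ℝ)) ∪ {h})) =
      (s.card + 1) * volume (cornerSimplex ι 1) := by
  have hmeas : ∀ i, MeasurableSet (replaceBasisVector h i '' cornerSimplex ι 1) := fun i =>
    ((isCompact_cornerSimplex ι 1).image
      (LinearMap.continuous_of_finiteDimensional _)).measurableSet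
  have hpiece : ∀ i ∈ s, ∀ x ∈ replaceBasisVector h i '' cornerSimplex ι 1,
      x i ≤ 0 ∧ ∀ j ∈ s, x i ≤ x j := by
    rintro i hi _ ⟨u, hu, rfl⟩
    have hii : replaceBasisVector h i u i = -u i := by
      simp [replaceBasisVector_apply, hs i hi]; ring
    refine ⟨by linarith [hu.1 i], fun j hj => ?_⟩
    rcases eq_or_ne j i with rfl | hji
    · rfl
    · rw [hii]
      simp [replaceBasisVector_apply, hs j hj, hji, hu.1 j]
  rw [convexHull_eq_union_cornerSimplex h s hs hs' hsum, measure_union₀, measure_biUnion_finset₀]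
  · rw [Finset.sum_congr rfl (g := fun _ => volume (cornerSimplex ι 1))]
    · simp only [Finset.sum_const, nsmul_eq_mul]
      ring
    · intro i hi
      simp [Measure.addHaar_image_linearMap, det_replaceBasisVector, hs i hi]
  · intro i hi j hj hij
    refine measure_mono_null (fun x hx => ?_)
      (volume_linearMap_eq_zero (LinearMap.proj (R := ℝ) (φ := fun _ => ℝ) i
        - LinearMap.proj (φ := fun _ => ℝ) j) fun hf => ?_)
    · exact sub_eq_zero.2 (((hpiece i hi x hx.1).2 j hj).antisymm ((hpiece j hj x hx.2).2 i hi))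
    · simpa [hij] using LinearMap.congr_fun hf (Pi.single i 1)
  · exact fun i _ => (hmeas i).nullMeasurableSet
  · exact (s.measurableSet_biUnion fun i _ => hmeas i).nullMeasurableSet
  · rw [AEDisjoint, Set.inter_iUnion₂]
    refine (measure_biUnion_null_iff s.countable_toSet).2 ?_
    intro i hi
    refine measure_mono_null (fun x hx => ?_)
      (volume_linearMap_eq_zero (LinearMap.proj (R := ℝ) (φ := fun _ => ℝ) i) fun hf => ?_)
    · exact (hpiece i hi x hx.2).1.antisymm (hx.1.1 i)
    · simpa using LinearMap.congr_fun hf (Pi.single i 1)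

/-- **Volume of the Newton polytope, case `2m ≤ n + 1`.** The convex hull in `ℝ^{n+2}` of
`0`, the standard basis vectors `e_1, …, e_{n+1}`, `e_{n+2} − e_{n+1}` and
`m·e_{n+2} − (e_1 + ⋯ + e_n)` has Lebesgue measure `(n+1)/(n+2)!`. -/
theorem newton_polytope_volume_ge
    (n m : ℕ) (hn : 1 ≤ n) (hm : 1 ≤ m) (h : 2 * m ≤ n + 1) :
    MeasureTheory.volume (convexHull ℝ
      (({0} ∪ (Set.range fun j : Fin (n + 1) => Pi.single j.castSucc (1 : ℝ))
        ∪ {Pi.single (Fin.last (n + 1)) (1 : ℝ)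
            - Pi.single (⟨n, by omega⟩ : Fin (n + 2)) (1 : ℝ)}
        ∪ {Pi.single (Fin.last (n + 1)) ((m : ℝ))
            - ∑ i : Fin n, Pi.single (Fin.castLE (by omega) i) (1 : ℝ)})
        : Set (Fin (n + 2) → ℝ)))
      = ENNReal.ofReal ((n + 1) / (Nat.factorial (n + 2))) := by
  let y : Fin (n + 2) := ⟨n, by omega⟩
  let h' : Fin (n + 2) → ℝ := fun j => if j.val < n then -1 else m
  let s : Finset (Fin (n + 2)) := Finset.univ.filter fun j => j.val < n
  let A : (Fin (n + 2) → ℝ) →ₗ[ℝ] (Fin (n + 2) → ℝ) :=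
    LinearMap.transvection (LinearMap.proj (Fin.last (n + 1))) (-Pi.single y 1)
  have hy : Fin.last (n + 1) ≠ y := by simp [y, Fin.ext_iff]
  have hA : LinearMap.det A = 1 := by
    simp [A, LinearMap.transvection.det, hy]
  have hA_apply : ∀ x, A x = x - x (Fin.last (n + 1)) • Pi.single y 1 := fun x => by
    simp [A, LinearMap.transvection.apply, sub_eq_add_neg]
  have hA_cast : ∀ j : Fin (n + 1),
      A (Pi.single j.castSucc 1) = Pi.single j.castSucc 1 := fun j => by
    simp [hA_apply, (Fin.castSucc_lt_last j).ne']
  have hA_last : A (Pi.single (Fin.last (n + 1)) 1) =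
      Pi.single (Fin.last (n + 1)) 1 - Pi.single y 1 := by
    simp [hA_apply]
  have hA_h : A h' = Pi.single (Fin.last (n + 1)) (m : ℝ)
      - ∑ i : Fin n, Pi.single (Fin.castLE (by omega) i) (1 : ℝ) := by
    ext j
    have hlast : h' (Fin.last (n + 1)) = m := by simp [h']
    simp only [hA_apply, hlast, Pi.sub_apply, Pi.smul_apply, Finset.sum_apply, smul_eq_mul]
    rcases lt_trichotomy j.val n with hj | hj | hj
    · have h1 : j ≠ y := fun e => by simp [e, y] at hj
      have h2 : j ≠ Fin.last (n + 1) := fun e => by simp [e] at hj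
      rw [Finset.sum_eq_single ⟨j.val, hj⟩]
      · simp [h', hj, h1, h2]
      · intro i _ hi
        exact Pi.single_eq_of_ne (fun e => hi (by simp [e])) _
      · simp
    · obtain rfl : j = y := Fin.ext hj
      rw [Finset.sum_eq_zero]
      · simp [h', y, hy.symm]
      · intro i _
        exact Pi.single_eq_of_ne (fun e => i.isLt.ne (congrArg Fin.val e).symm) _
    · obtain rfl : j = Fin.last (n + 1) := Fin.ext (by simp; omega)
      rw [Finset.sum_eq_zero]
      · simp [h', hy]
      · intro i _
        exact Pi.single_eq_of_ne (fun e => by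
          have := congrArg Fin.val e
          simp at this
          omega) _
  have himage : (({0} ∪ (Set.range fun j : Fin (n + 1) => Pi.single j.castSucc (1 : ℝ))
        ∪ {Pi.single (Fin.last (n + 1)) (1 : ℝ)
            - Pi.single (⟨n, by omega⟩ : Fin (n + 2)) (1 : ℝ)}
        ∪ {Pi.single (Fin.last (n + 1)) ((m : ℝ))
            - ∑ i : Fin n, Pi.single (Fin.castLE (by omega) i) (1 : ℝ)})
        : Set (Fin (n + 2) → ℝ)) =
      A '' ({0} ∪ Set.range (fun i => (Pi.single i 1 : Fin (n + 2) → ℝ)) ∪ {h'}) := by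
    rw [Set.image_union, Set.image_union, Set.image_singleton, Set.image_singleton, map_zero,
      hA_h, ← Set.range_comp, Set.union_assoc {0}]
    congr 2
    ext x
    simp only [Set.mem_union, Set.mem_range, Set.mem_singleton_iff, Function.comp_apply]
    rw [Fin.exists_fin_succ' (P := fun i => A (Pi.single i 1) = x)]
    simp only [hA_cast, hA_last]
    exact or_congr Iff.rfl eq_comm
  have hcard : s.card = n := by
    have : s = Finset.univ.map (Fin.castLEEmb (by omega : n ≤ n + 2)) := by
      ext j
      simp only [s, Finset.mem_filter, Finset.mem_univ, true_and, Finset.mem_map]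
      exact ⟨fun hj => ⟨⟨j.val, hj⟩, rfl⟩, by rintro ⟨i, rfl⟩; exact i.isLt⟩
    simp [this]
  have hsum : ∑ i, h' i ≤ 1 := by
    have h2 : (2 * m : ℝ) ≤ n + 1 := by exact_mod_cast h
    simp only [h', Fin.sum_univ_castSucc]
    simp
    linarith
  rw [himage, ← LinearMap.image_convexHull, Measure.addHaar_image_linearMap, hA,
    volume_convexHull_eq_mul h' s (fun i hi => if_pos (Finset.mem_filter.1 hi).2)
      (fun i hi => by simp [h', show ¬ i.val < n by simpa [s] using hi]) hsum,
    volume_cornerSimplex _ zero_le_one, hcard, abs_one, ENNReal.ofReal_one, one_mul, one_pow,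
    show (n + 1 : ENNReal) = ENNReal.ofReal (n + 1) by
      rw [ENNReal.ofReal_add (by positivity) zero_le_one]; simp,
    ← ENNReal.ofReal_mul (by positivity), mul_one_div]
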